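/- arXiv:2411.00968 — 2 statements merged into one kernel-verified Lean document; each statement's English description precedes it below -/
import Mathlib

section
/- Let Λ be a colattice and let n > 0 be an integer. Then the restriction homomorphism Λ^∨ = Hom(Λ, ℚ/ℤ) → Hom(Λ[n], ℚ/ℤ), given by restricting a character of Λ to the n-torsion subgroup Λ[n], is surjective, and its kernel is exactly the subgroup n·Λ^∨ of characters divisible by n. Consequently it induces a group isomorphism Λ^∨/(n·Λ^∨) ≅ Hom(Λ[n], ℚ/ℤ), and in particular the quotient Λ^∨/(n·Λ^∨) is a finite group. -/
/-!
Statement 7: for a colattice `Λ` and `n > 0`, the restriction map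
`Λ^∨ = Hom(Λ, ℚ/ℤ) → Hom(Λ[n], ℚ/ℤ)` is surjective with kernel `n·Λ^∨`, inducing an
isomorphism `Λ^∨/(n·Λ^∨) ≅ Hom(Λ[n], ℚ/ℤ)`; in particular the quotient is finite.
-/

/-- The circle group `ℚ/ℤ`. -/
abbrev QZ : Type := AddCircle (1 : ℚ)

/-- The `n`-torsion subgroup `Λ[n]` of an abelian group. -/
def nTors (Λ : Type*) [AddCommGroup Λ] (n : ℕ) : AddSubgroup Λ where
  carrier := {x | n • x = 0}
  zero_mem' := by simp
  add_mem' := by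
    intro a b ha hb
    simp only [Set.mem_setOf_eq, smul_add] at *
    rw [ha, hb, add_zero]
  neg_mem' := by
    intro a ha
    simp only [Set.mem_setOf_eq, smul_neg] at *
    rw [ha, neg_zero]

/-- The restriction homomorphism `Hom(Λ, ℚ/ℤ) →+ Hom(Λ[n], ℚ/ℤ)`. -/
def resHom (Λ : Type*) [AddCommGroup Λ] (n : ℕ) : (Λ →+ QZ) →+ ((nTors Λ n) →+ QZ) :=
  AddMonoidHom.mk' (fun χ => χ.comp (nTors Λ n).subtype) (fun _ _ => rfl)

/-- Multiplication by `n` as an endomorphism of an abelian group. -/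
def nSmulHom (M : Type*) [AddCommGroup M] (n : ℕ) : M →+ M :=
  AddMonoidHom.mk' (fun x => n • x) (fun a b => smul_add n a b)

theorem colattice_dual_restriction_surjective_ker_smul
    (Λ : Type*) [AddCommGroup Λ]
    -- `Λ` is a colattice:
    (htors : ∀ x : Λ, ∃ n : ℕ, 0 < n ∧ n • x = 0)
    (hsurj : ∀ n : ℕ, 0 < n → Function.Surjective (fun x : Λ => n • x))
    (hfin : ∀ n : ℕ, 0 < n → Finite (nTors Λ n))
    (n : ℕ) (hn : 0 < n) :
    -- the restriction map is surjective:
    Function.Surjective (resHom Λ n) ∧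
    -- its kernel is exactly `n · Λ^∨`:
    (resHom Λ n).ker = (nSmulHom (Λ →+ QZ) n).range ∧
    -- consequently, it induces an isomorphism `Λ^∨/(n·Λ^∨) ≅ Hom(Λ[n], ℚ/ℤ)`:
    (∃ e : ((Λ →+ QZ) ⧸ (nSmulHom (Λ →+ QZ) n).range) ≃+ ((nTors Λ n) →+ QZ),
      ∀ χ : Λ →+ QZ, e (QuotientAddGroup.mk χ) = resHom Λ n χ) ∧
    -- and in particular the quotient `Λ^∨/(n·Λ^∨)` is finite:
    Finite ((Λ →+ QZ) ⧸ (nSmulHom (Λ →+ QZ) n).range) := by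
  have h1 : Function.Surjective (resHom Λ n) := by
    intro f
    obtain ⟨g, hg⟩ := CharacterModule.dual_surjective_of_injective (R := ℤ)
      (nTors Λ n).subtype.toIntLinearMap (Subtype.val_injective) f
    exact ⟨g, hg⟩
  have h2 : (resHom Λ n).ker = (nSmulHom (Λ →+ QZ) n).range := by
    ext χ
    constructor
    · intro hχ
      have hker : (nSmulHom Λ n).ker ≤ χ.ker := by
        intro x hx
        exact DFunLike.congr_fun (show resHom Λ n χ = 0 from hχ) (⟨x, hx⟩ : nTors Λ n)
      have hs : Function.Surjective (nSmulHom Λ n) := hsurj n hn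
      refine ⟨(nSmulHom Λ n).liftOfSurjective hs ⟨χ, hker⟩, ?_⟩
      ext x
      have h := AddMonoidHom.liftOfRightInverse_comp_apply (nSmulHom Λ n) _
        (Function.rightInverse_surjInv hs) ⟨χ, hker⟩ x
      refine Eq.trans ?_ h
      exact (map_nsmul ((nSmulHom Λ n).liftOfSurjective hs ⟨χ, hker⟩) n x).symm
    · rintro ⟨ψ, rfl⟩
      show resHom Λ n (n • ψ) = 0
      ext x
      have hx : n • (x : Λ) = 0 := x.2
      show n • ψ (x : Λ) = 0
      rw [← map_nsmul, hx, map_zero]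
  let e : ((Λ →+ QZ) ⧸ (nSmulHom (Λ →+ QZ) n).range) ≃+ ((nTors Λ n) →+ QZ) :=
    (QuotientAddGroup.quotientAddEquivOfEq h2.symm).trans
      (QuotientAddGroup.quotientKerEquivOfSurjective (resHom Λ n) h1)
  refine ⟨h1, h2, ⟨e, fun χ => rfl⟩, ?_⟩
  have : Finite (nTors Λ n) := hfin n hn
  have : Finite {u : QZ | n • u = 0} := AddCircle.finite_torsion (1 : ℚ) hn
  have : Finite ((nTors Λ n) →+ QZ) := by
    refine Finite.of_injective
      (fun (f : (nTors Λ n) →+ QZ) (x : nTors Λ n) => (⟨f x, ?_⟩ : {u : QZ | n • u = 0})) ?_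
    · have hx : n • x = 0 := Subtype.ext x.2
      show n • f x = 0
      rw [← map_nsmul, hx, map_zero]
    · intro f g h
      ext x
      exact congrArg Subtype.val (congrFun h x)
  exact Finite.of_equiv _ e.symm.toEquiv
end

section
/- Let Λ be a colattice and let H be a finite abelian group. Then the set Hom(Λ^∨, H) of abelian-group homomorphisms from Λ^∨ = Hom(Λ, ℚ/ℤ) to H is finite. -/
theorem colattice_hom_dual_finite
    (Λ : Type*) [AddCommGroup Λ]
    -- `Λ` is a colattice:
    (htors : ∀ x : Λ, ∃ n : ℕ, 0 < n ∧ n • x = 0)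
    (hsurj : ∀ n : ℕ, 0 < n → Function.Surjective (fun x : Λ => n • x))
    (hfin : ∀ n : ℕ, 0 < n → Finite (nTors Λ n))
    (H : Type*) [AddCommGroup H] [Finite H] :
    Finite ((Λ →+ QZ) →+ H) := by
  classical
  set n := Nat.card H with hn
  have npos : 0 < n := Nat.card_pos
  have : Finite (nTors Λ n) := hfin n npos
  have hT : Finite {u : QZ | n • u = 0} :=
    (AddCircle.finite_torsion (1 : ℚ) npos).to_subtype
  have hA : Finite (nTors Λ n →+ QZ) := by
    refine Finite.of_injective
      (fun (f : nTors Λ n →+ QZ) (x : nTors Λ n) =>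
        (⟨f x, ?_⟩ : {u : QZ | n • u = 0})) ?_
    · have hx : n • x = 0 := Subtype.ext x.2
      change n • f x = 0
      rw [← map_nsmul, hx, map_zero]
    · intro f g h
      ext x
      exact congrArg Subtype.val (congrFun h x)
  -- a character vanishing on the `n`-torsion is `n` times a character
  have key : ∀ χ : Λ →+ QZ, (∀ x : Λ, n • x = 0 → χ x = 0) →
      ∃ ψ : Λ →+ QZ, χ = n • ψ := by
    intro χ hχ
    choose s hs using hsurj n npos
    have hs' : ∀ y, n • s y = y := hs
    have hwd : ∀ a b : Λ, n • a = n • b → χ a = χ b := by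
      intro a b h
      have := hχ (a - b) (by rw [smul_sub, h, sub_self])
      rwa [map_sub, sub_eq_zero] at this
    refine ⟨AddMonoidHom.mk' (fun y => χ (s y)) ?_, ?_⟩
    · intro a b
      rw [← map_add]
      apply hwd
      rw [smul_add, hs', hs', hs']
    · ext x
      change χ x = n • χ (s x)
      rw [← map_nsmul, hs']
  let res : (Λ →+ QZ) → (nTors Λ n →+ QZ) := fun χ => χ.comp (nTors Λ n).subtype
  refine Finite.of_injective
    (fun (F : (Λ →+ QZ) →+ H) (r : Set.range res) => F r.2.choose) ?_
  have hF : ∀ (F : (Λ →+ QZ) →+ H) (χ χ' : Λ →+ QZ), res χ = res χ' → F χ = F χ' := by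
    intro F χ χ' h
    obtain ⟨ψ, hψ⟩ := key (χ - χ') (by
      intro x hx
      have := DFunLike.congr_fun h (⟨x, hx⟩ : nTors Λ n)
      change χ x - χ' x = 0
      exact sub_eq_zero.mpr this)
    rw [← sub_eq_zero, ← map_sub, hψ, map_nsmul, hn, card_nsmul_eq_zero']
  intro F G h
  refine AddMonoidHom.ext fun χ => ?_
  have hr : res χ ∈ Set.range res := ⟨χ, rfl⟩
  have h1 := congrFun h ⟨res χ, hr⟩
  have hc := hr.choose_spec
  rw [← hF F _ _ hc, ← hF G _ _ hc]
  exact h1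
end
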